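/- Let A be an invertible real 2×2 matrix, ζ ∈ ℝ², α, u ∈ ℝ, and suppose v : ℝ → ℝ² and z : ℝ → ℝ are differentiable with v'(t) = Av(t) + uζ and z'(t) = (u/2)·ω(v(t),ζ) + uα for all t. Then for all t ∈ ℝ, z(t) − (u/(2·det A))·ω(v(t), Aζ) = z(0) − (u/(2·det A))·ω(v(0), Aζ) + t·p(u), where p(u) = (u²/(2·det A))·ω(Aζ,ζ) + uα. In particular, the constant curve v(t) ≡ −uA⁻¹ζ solves the v-equation, and the solution through (−uA⁻¹ζ, z₀) is t ↦ (−uA⁻¹ζ, z₀ + t·p(u)). -/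

import Mathlib

open Set Matrix

noncomputable section

/-- Vectors in the plane. -/
abbrev V2 := Fin 2 → ℝ

/-- The standard symplectic form on `ℝ²`: `ω(v,w) = v₁w₂ − v₂w₁`. -/
def omega2 (v w : V2) : ℝ := v 0 * w 1 - v 1 * w 0

/-- Counterclockwise rotation by `π/2`. -/
def theta (v : V2) : V2 := ![-(v 1), v 0]

/-- The bracket of the Heisenberg Lie algebra `𝔥 = ℝ² × ℝ`:
`[(ζ₁,α₁),(ζ₂,α₂)] = (0, ω(ζ₁,ζ₂))`. -/
def hbracket (x y : V2 × ℝ) : V2 × ℝ := ((0 : V2), omega2 x.1 y.1)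

/-- The linear map `𝒟(v,z) = (Av, ω(v,θη) + (tr A) z)` on `𝔥 = ℝ² × ℝ`. -/
def Dmap (A : Matrix (Fin 2) (Fin 2) ℝ) (η : V2) (p : V2 × ℝ) : V2 × ℝ :=
  (A.mulVec p.1, omega2 p.1 (theta η) + A.trace * p.2)

theorem omega2_mulVec_mulVec (A : Matrix (Fin 2) (Fin 2) ℝ) (v w : V2) :
    omega2 (A.mulVec v) (A.mulVec w) = A.det * omega2 v w := by
  simp only [omega2, Matrix.mulVec, dotProduct, Fin.sum_univ_two, Matrix.det_fin_two]
  ring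

theorem omega2_swap (v w : V2) : omega2 v w = -omega2 w v := by
  simp only [omega2]
  ring

theorem omega2_add_left (v₁ v₂ w : V2) :
    omega2 (v₁ + v₂) w = omega2 v₁ w + omega2 v₂ w := by
  simp only [omega2, Pi.add_apply]
  ring

theorem omega2_smul_left (c : ℝ) (v w : V2) : omega2 (c • v) w = c * omega2 v w := by
  simp only [omega2, Pi.smul_apply, smul_eq_mul]
  ring

theorem HasDerivAt.omega2_const {v : ℝ → V2} {v' : V2} {t : ℝ} (hv : HasDerivAt v v' t)
    (w : V2) : HasDerivAt (fun s => omega2 (v s) w) (omega2 v' w) t :=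
  ((hasDerivAt_pi.1 hv 0).mul_const (w 1)).sub ((hasDerivAt_pi.1 hv 1).mul_const (w 0))

theorem eq_add_mul_of_hasDerivAt_const {f : ℝ → ℝ} {c : ℝ} (hf : ∀ t, HasDerivAt f c t)
    (t : ℝ) : f t = f 0 + t * c := by
  have hg : ∀ s, HasDerivAt (fun s => f s - s * c) 0 s := fun s =>
    ((hf s).sub ((hasDerivAt_id s).mul_const c)).congr_deriv (by ring)
  have h := is_const_of_deriv_eq_zero (fun s => (hg s).differentiableAt)
    (fun s => (hg s).deriv) t 0
  linarith

/-- for `A` invertible, `tr A = 0`-type `z`-dynamics with constant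
control `u`: along any solution of `v̇ = Av + uζ`, `ż = (u/2)ω(v,ζ) + uα`, the
quantity `z − (u/(2 det A)) ω(v, Aζ)` is affine in time with slope
`p(u) = (u²/(2 det A)) ω(Aζ,ζ) + uα`; moreover the constant curve `v ≡ −uA⁻¹ζ`
solves the `v`-equation and the solution through `(−uA⁻¹ζ, z₀)` is
`t ↦ (−uA⁻¹ζ, z₀ + t p(u))`. -/
theorem stmt15 (A : Matrix (Fin 2) (Fin 2) ℝ) (ζ : V2) (α u : ℝ)
    (hA : A.det ≠ 0) (v : ℝ → V2) (z : ℝ → ℝ)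
    (hv : ∀ t : ℝ, HasDerivAt v (A.mulVec (v t) + u • ζ) t)
    (hz : ∀ t : ℝ, HasDerivAt z (u / 2 * omega2 (v t) ζ + u * α) t) :
    (∀ t : ℝ, z t - u / (2 * A.det) * omega2 (v t) (A.mulVec ζ) =
        z 0 - u / (2 * A.det) * omega2 (v 0) (A.mulVec ζ) +
          t * (u ^ 2 / (2 * A.det) * omega2 (A.mulVec ζ) ζ + u * α)) ∧
    (A.mulVec ((-u) • A⁻¹.mulVec ζ) + u • ζ = 0) ∧
    (∀ z₀ t : ℝ,
      HasDerivAt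
        (fun s : ℝ => ((((-u) • A⁻¹.mulVec ζ : V2),
          z₀ + s * (u ^ 2 / (2 * A.det) * omega2 (A.mulVec ζ) ζ + u * α)) : V2 × ℝ))
        ((A.mulVec ((-u) • A⁻¹.mulVec ζ) + u • ζ,
          u / 2 * omega2 ((-u) • A⁻¹.mulVec ζ) ζ + u * α) : V2 × ℝ) t) := by
  have hinv : A.mulVec (A⁻¹.mulVec ζ) = ζ := by
    rw [Matrix.mulVec_mulVec, Matrix.mul_nonsing_inv A (isUnit_iff_ne_zero.2 hA),
      Matrix.one_mulVec]
  have heq : A.mulVec ((-u) • A⁻¹.mulVec ζ) + u • ζ = 0 := by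
    rw [Matrix.mulVec_smul, hinv, neg_smul, neg_add_cancel]
  refine ⟨fun t => ?_, heq, fun z₀ t => ?_⟩
  · refine eq_add_mul_of_hasDerivAt_const
      (f := fun t => z t - u / (2 * A.det) * omega2 (v t) (A.mulVec ζ)) (fun s => ?_) t
    refine ((hz s).sub (((hv s).omega2_const (A.mulVec ζ)).const_mul
      (u / (2 * A.det)))).congr_deriv ?_
    rw [omega2_add_left, omega2_smul_left, omega2_mulVec_mulVec, omega2_swap ζ]
    field_simp
    ring
  · rw [heq]
    refine (hasDerivAt_const t _).prodMk ?_
    refine (((hasDerivAt_id t).mul_const _).const_add z₀).congr_deriv ?_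
    have h := omega2_mulVec_mulVec A (A⁻¹.mulVec ζ) ζ
    rw [hinv, omega2_swap] at h
    rw [omega2_smul_left, neg_eq_iff_eq_neg.1 h]
    field_simp
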